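/- Let n and m be positive even integers, μ ∈ {1,…,n/2}, ρ ∈ {1,…,m/2}. Let φ = (φ₁,…,φ_{n/2}) : 𝔽₂^{n/2} → 𝔽₂^{n/2} and ψ = (ψ₁,…,ψ_{m/2}) : 𝔽₂^{m/2} → 𝔽₂^{m/2} be bijections (Boolean permutations), and let u : 𝔽₂^{n/2} → 𝔽₂ and v : 𝔽₂^{m/2} → 𝔽₂ be arbitrary. Then the (n+m−2)-variable function h, in the variables x_i (1 ≤ i ≤ n, i ≠ μ) and y_j (1 ≤ j ≤ m, j ≠ ρ), defined by h(x,y) = ⨁_{i=1, i≠μ}^{n/2} φ_i(x_{n/2+1},…,x_n)·x_i ⊕ ⨁_{j=1, j≠ρ}^{m/2} ψ_j(y_{m/2+1},…,y_m)·y_j ⊕ φ_μ(x_{n/2+1},…,x_n)·ψ_ρ(y_{m/2+1},…,y_m) ⊕ u(x_{n/2+1},…,x_n) ⊕ v(y_{m/2+1},…,y_m), is a bent function in n+m−2 variables. -/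

import Mathlib

open Finset

/-- The sign `(-1)^b` for `b ∈ 𝔽₂`. -/
def chi (b : ZMod 2) : ℤ := if b = 0 then 1 else -1

/-- The Walsh transform of a Boolean function in `n` variables. -/
def walsh {n : ℕ} (f : (Fin n → ZMod 2) → ZMod 2) (ω : Fin n → ZMod 2) : ℤ :=
  ∑ x : Fin n → ZMod 2, chi (f x + ∑ i, ω i * x i)

/-- The Walsh transform of a Boolean function given on a product `𝔽₂ⁿ × 𝔽₂^m`. -/
def walsh2 {n m : ℕ} (f : (Fin n → ZMod 2) → (Fin m → ZMod 2) → ZMod 2)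
    (α : Fin n → ZMod 2) (β : Fin m → ZMod 2) : ℤ :=
  ∑ x : Fin n → ZMod 2, ∑ y : Fin m → ZMod 2,
    chi (f x y + (∑ i, α i * x i) + (∑ j, β j * y j))

/-- A Boolean function in `n` variables is bent if its Walsh transform only
takes the values `±2^(n/2)`. -/
def IsBent (n : ℕ) (f : (Fin n → ZMod 2) → ZMod 2) : Prop :=
  ∀ a, walsh f a = 2 ^ (n / 2) ∨ walsh f a = -(2 ^ (n / 2))

/-- Bentness for a function given on a product, i.e. as a function in `n + m` variables. -/
def IsBent2 (n m : ℕ) (f : (Fin n → ZMod 2) → (Fin m → ZMod 2) → ZMod 2) : Prop :=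
  ∀ α β, walsh2 f α β = 2 ^ ((n + m) / 2) ∨ walsh2 f α β = -(2 ^ ((n + m) / 2))

/-- `fd` is the dual of a bent function `f`:  `W_f(ω) = 2^(n/2) (−1)^{fd(ω)}`. -/
def IsDual {n : ℕ} (f fd : (Fin n → ZMod 2) → ZMod 2) : Prop :=
  ∀ ω, walsh f ω = 2 ^ (n / 2) * chi (fd ω)

/-- The dual for a bent function given on a product (a function of `n + m` variables). -/
def IsDual2 {n m : ℕ} (f fd : (Fin n → ZMod 2) → (Fin m → ZMod 2) → ZMod 2) : Prop :=
  ∀ α β, walsh2 f α β = 2 ^ ((n + m) / 2) * chi (fd α β)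

/-- Insert the bit `b` at position `μ`, giving a vector of length `n` from one of length `n-1`. -/
def insertAt {n : ℕ} (μ : Fin n) (b : ZMod 2) (x : Fin (n - 1) → ZMod 2) : Fin n → ZMod 2 :=
  fun i =>
    if h : (i : ℕ) < (μ : ℕ) then x ⟨i, by have := μ.isLt; omega⟩
    else if h' : (μ : ℕ) < (i : ℕ) then x ⟨(i : ℕ) - 1, by have := i.isLt; omega⟩
    else b

/-- Hamming weight of a vector in `𝔽₂ⁿ`. -/
def wt {n : ℕ} (ω : Fin n → ZMod 2) : ℕ := (Finset.univ.filter fun i => ω i ≠ 0).card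

/-- `t`-resiliency (with `t : ℤ`, so that the convention that every function is
`(-1)`-resilient holds). -/
def Resilient {n : ℕ} (t : ℤ) (f : (Fin n → ZMod 2) → ZMod 2) : Prop :=
  ∀ ω, (wt ω : ℤ) ≤ t → walsh f ω = 0

/-- `t`-resiliency for a function given on a product `𝔽₂ⁿ × 𝔽₂^m`. -/
def Resilient2 {n m : ℕ} (t : ℤ) (f : (Fin n → ZMod 2) → (Fin m → ZMod 2) → ZMod 2) : Prop :=
  ∀ α β, (wt α + wt β : ℤ) ≤ t → walsh2 f α β = 0

theorem chi_add (a b : ZMod 2) : chi (a + b) = chi a * chi b := by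
  revert a b; decide

theorem chi_eq_one_or_neg_one (a : ZMod 2) : chi a = 1 ∨ chi a = -1 := by
  revert a; decide

theorem chi_sum {ι : Type*} (S : Finset ι) (f : ι → ZMod 2) :
    chi (∑ i ∈ S, f i) = ∏ i ∈ S, chi (f i) := by
  classical
  induction S using Finset.induction_on with
  | empty => simp [chi]
  | insert a S ha ih => rw [sum_insert ha, prod_insert ha, chi_add, ih]

/-- Orthogonality of the characters of `𝔽₂^ι`. -/
theorem sum_chi_linear {ι : Type*} [Fintype ι] [DecidableEq ι] (c : ι → ZMod 2) :
    ∑ p : ι → ZMod 2, chi (∑ i, c i * p i) = if c = 0 then 2 ^ Fintype.card ι else 0 := by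
  have key : ∀ a : ZMod 2, ∑ b, chi (a * b) = if a = 0 then 2 else 0 := by decide
  simp_rw [chi_sum]
  rw [← Fintype.piFinset_univ, ← prod_univ_sum (fun _ => univ) fun i b => chi (c i * b)]
  simp_rw [key]
  split_ifs with hc
  · simp [hc]
  · obtain ⟨i, hi⟩ := Function.ne_iff.mp hc
    exact prod_eq_zero (mem_univ i) (if_neg hi)

/-- The position of the variable `x_i`, `i ≠ μ`, after `x_μ` has been removed. -/
def headIndex {s : ℕ} (μ i : Fin s) : Fin (2 * s - 1) :=
  ⟨if (i : ℕ) < (μ : ℕ) then (i : ℕ) else (i : ℕ) - 1, by have := i.isLt; split <;> omega⟩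

/-- The position of the variable `x_{s+k}` after one of the first `s` variables has been
removed. -/
def tailIndex {s : ℕ} (k : Fin s) : Fin (2 * s - 1) :=
  ⟨s + (k : ℕ) - 1, by have := k.isLt; omega⟩

theorem bijective_headIndex_tailIndex {s : ℕ} (μ : Fin s) :
    Function.Bijective
      (Sum.elim (fun i : {i : Fin s // i ≠ μ} => headIndex μ i) (tailIndex : Fin s → _)) := by
  rw [Fintype.bijective_iff_injective_and_card]
  have hμ := μ.isLt
  constructor
  · rintro (⟨i, hi⟩ | i) (⟨j, hj⟩ | j) hij <;>
      simp only [Sum.elim_inl, Sum.elim_inr, headIndex, tailIndex, Fin.mk.injEq] at hij <;>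
      have hi' := i.isLt <;> have hj' := j.isLt
    · rw [← Fin.val_ne_iff] at hi hj
      have : i = j := by ext; split_ifs at hij <;> omega
      simp [this]
    · rw [← Fin.val_ne_iff] at hi
      split_ifs at hij <;> omega
    · rw [← Fin.val_ne_iff] at hj
      split_ifs at hij <;> omega
    · have : i = j := by ext; omega
      rw [this]
  · simp only [Fintype.card_sum, Fintype.card_fin, Fintype.card_subtype_compl,
      Fintype.card_unique]
    omega

/-- The partial Walsh sum of a Maiorana–McFarland function with the variable `x_μ` removed,
over the points where `φ_μ` takes the value `a`. -/
def partialWalsh {s : ℕ} (φ : Fin s → (Fin s → ZMod 2) → ZMod 2) (u : (Fin s → ZMod 2) → ZMod 2)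
    (μ : Fin s) (α : Fin (2 * s - 1) → ZMod 2) (a : ZMod 2) : ℤ :=
  ∑ x : Fin (2 * s - 1) → ZMod 2,
    if φ μ (fun k => x (tailIndex k)) = a then
      chi (∑ i ∈ univ.erase μ, φ i (fun k => x (tailIndex k)) * x (headIndex μ i) +
        u (fun k => x (tailIndex k)) + ∑ i, α i * x i)
    else 0

theorem partialWalsh_eq_or_eq_neg {s : ℕ} (φ : Fin s → (Fin s → ZMod 2) → ZMod 2)
    (hφ : Function.Bijective fun w : Fin s → ZMod 2 => fun i => φ i w)
    (u : (Fin s → ZMod 2) → ZMod 2) (μ : Fin s) (α : Fin (2 * s - 1) → ZMod 2) (a : ZMod 2) :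
    partialWalsh φ u μ α a = 2 ^ (s - 1) ∨ partialWalsh φ u μ α a = -2 ^ (s - 1) := by
  let e := Equiv.ofBijective _ (bijective_headIndex_tailIndex μ)
  let E : ({i : Fin s // i ≠ μ} → ZMod 2) × (Fin s → ZMod 2) ≃ (Fin (2 * s - 1) → ZMod 2) :=
    (Equiv.sumArrowEquivProdArrow _ _ _).symm.trans (e.arrowCongr (Equiv.refl _))
  have hE (p) (j) : E p (e j) = Sum.elim p.1 p.2 j := by rcases j with j | j <;> simp [E, Equiv.sumArrowEquivProdArrow]
  have hhead (p) (i : {i : Fin s // i ≠ μ}) : E p (headIndex μ i) = p.1 i := hE p (Sum.inl i)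
  have htail (p) (k : Fin s) : E p (tailIndex k) = p.2 k := hE p (Sum.inr k)
  have herase (f : Fin s → ZMod 2) :
      ∑ i ∈ univ.erase μ, f i = ∑ i : {i : Fin s // i ≠ μ}, f i :=
    sum_subtype _ (by simp) f
  have hlin (p) : ∑ i, α i * E p i =
      ∑ i : {i : Fin s // i ≠ μ}, α (headIndex μ i) * p.1 i +
        ∑ k, α (tailIndex k) * p.2 k := by
    rw [← e.sum_comp, Fintype.sum_sum_type]
    simp only [hE]
    rfl
  obtain ⟨w₀, hw₀⟩ := hφ.2 fun i => if i = μ then a else α (headIndex μ i)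
  have hw₀' (i : Fin s) : φ i w₀ = if i = μ then a else α (headIndex μ i) := congrFun hw₀ i
  have hcard : Fintype.card {i : Fin s // i ≠ μ} = s - 1 := by simp
  have hsum : partialWalsh φ u μ α a = ∑ w : Fin s → ZMod 2,
      if φ μ w = a then
        chi (u w + ∑ k, α (tailIndex k) * w k) *
          (if (fun i : {i : Fin s // i ≠ μ} => φ i w + α (headIndex μ i)) = 0
            then 2 ^ (s - 1) else 0)
      else 0 := by
    rw [partialWalsh, ← E.sum_comp, Fintype.sum_prod_type_right]
    refine sum_congr rfl fun w _ => ?_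
    simp only [htail, hlin, herase, hhead]
    by_cases ha : φ μ w = a
    · simp only [if_pos ha]
      rw [← hcard, ← sum_chi_linear, mul_sum]
      refine sum_congr rfl fun p _ => ?_
      rw [← chi_add]
      congr 1
      simp only [add_mul, sum_add_distrib]
      ring
    · simp [ha]
  have hval : partialWalsh φ u μ α a =
      chi (u w₀ + ∑ k, α (tailIndex k) * w₀ k) * 2 ^ (s - 1) := by
    rw [hsum, sum_eq_single w₀]
    · rw [if_pos (by simp [hw₀']), if_pos]
      ext ⟨i, hi⟩
      simp [hw₀', hi, CharTwo.add_self_eq_zero]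
    · intro w _ hw
      split_ifs with ha hc
      · refine absurd (hφ.1 ?_) hw
        ext1 i
        by_cases hi : i = μ
        · simp [hw₀', hi, ha]
        · simpa [hw₀', hi, CharTwo.add_eq_zero] using congrFun hc ⟨i, hi⟩
      · simp
      · rfl
    · simp
  rw [hval]
  rcases chi_eq_one_or_neg_one (u w₀ + ∑ k, α (tailIndex k) * w₀ k) with h | h <;> simp [h]

/-- a primary construction of bent functions in `n + m - 2 = 2s + 2t - 2`
variables from Boolean permutations `φ` of `𝔽₂^s` and `ψ` of `𝔽₂^t` (Corollary on
Maiorana–McFarland-like functions).  The first argument `x` of `h` carries the original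
variables `x_1, …, x_n` with `x_μ` removed, and similarly for `y`. -/
theorem bent_MM_like_construction (s t : ℕ) (hs : 0 < s) (ht : 0 < t)
    (φ : Fin s → (Fin s → ZMod 2) → ZMod 2)
    (ψ : Fin t → (Fin t → ZMod 2) → ZMod 2)
    (hφ : Function.Bijective fun w : Fin s → ZMod 2 => fun i => φ i w)
    (hψ : Function.Bijective fun w : Fin t → ZMod 2 => fun j => ψ j w)
    (u : (Fin s → ZMod 2) → ZMod 2) (v : (Fin t → ZMod 2) → ZMod 2)
    (μ : Fin s) (ρ : Fin t)
    (h : (Fin (2 * s - 1) → ZMod 2) → (Fin (2 * t - 1) → ZMod 2) → ZMod 2)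
    (hh : ∀ x y,
      h x y =
        (∑ i ∈ Finset.univ.erase μ,
            φ i (fun k => x ⟨s + (k : ℕ) - 1, by have := k.isLt; omega⟩) *
              x ⟨if (i : ℕ) < (μ : ℕ) then (i : ℕ) else (i : ℕ) - 1,
                 by have := i.isLt; split <;> omega⟩) +
        (∑ j ∈ Finset.univ.erase ρ,
            ψ j (fun k => y ⟨t + (k : ℕ) - 1, by have := k.isLt; omega⟩) *
              y ⟨if (j : ℕ) < (ρ : ℕ) then (j : ℕ) else (j : ℕ) - 1,
                 by have := j.isLt; split <;> omega⟩) +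
        φ μ (fun k => x ⟨s + (k : ℕ) - 1, by have := k.isLt; omega⟩) *
          ψ ρ (fun k => y ⟨t + (k : ℕ) - 1, by have := k.isLt; omega⟩) +
        u (fun k => x ⟨s + (k : ℕ) - 1, by have := k.isLt; omega⟩) +
        v (fun k => y ⟨t + (k : ℕ) - 1, by have := k.isLt; omega⟩)) :
    IsBent2 (2 * s - 1) (2 * t - 1) h := by
  have hh' (x y) : h x y =
      (∑ i ∈ univ.erase μ, φ i (fun k => x (tailIndex k)) * x (headIndex μ i)) +
      (∑ j ∈ univ.erase ρ, ψ j (fun k => y (tailIndex k)) * y (headIndex ρ j)) +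
      φ μ (fun k => x (tailIndex k)) * ψ ρ (fun k => y (tailIndex k)) +
      u (fun k => x (tailIndex k)) + v (fun k => y (tailIndex k)) := hh x y
  intro α β
  have hW : walsh2 h α β =
      ∑ a, ∑ b, chi (a * b) * (partialWalsh φ u μ α a * partialWalsh ψ v ρ β b) := by
    have hpt (x : Fin (2 * s - 1) → ZMod 2) (y : Fin (2 * t - 1) → ZMod 2) :
        chi (h x y + ∑ i, α i * x i + ∑ j, β j * y j) =
          ∑ a, ∑ b, chi (a * b) *
            ((if φ μ (fun k => x (tailIndex k)) = a then
              chi (∑ i ∈ univ.erase μ, φ i (fun k => x (tailIndex k)) * x (headIndex μ i) +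
                u (fun k => x (tailIndex k)) + ∑ i, α i * x i) else 0) *
            (if ψ ρ (fun k => y (tailIndex k)) = b then
              chi (∑ j ∈ univ.erase ρ, ψ j (fun k => y (tailIndex k)) * y (headIndex ρ j) +
                v (fun k => y (tailIndex k)) + ∑ j, β j * y j) else 0)) := by
      simp only [ite_mul, mul_ite, zero_mul, mul_zero, sum_ite_eq, mem_univ, if_true]
      rw [← chi_add, ← chi_add, hh']
      congr 1
      ring
    simp only [walsh2, hpt, partialWalsh, sum_mul_sum]
    rw [← Fintype.sum_prod_type', sum_comm]
    refine sum_congr rfl fun a _ => ?_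
    rw [sum_comm]
    refine sum_congr rfl fun b _ => ?_
    simp only [mul_sum, Fintype.sum_prod_type]
  have hexp : (2 * s - 1 + (2 * t - 1)) / 2 = (s - 1) + (t - 1) + 1 := by omega
  have hsplit (F : ZMod 2 → ℤ) : ∑ a, F a = F 0 + F 1 := Fin.sum_univ_two F
  have h₀ : chi 0 = 1 := rfl
  have h₁ : chi 1 = -1 := rfl
  rw [hW, hexp, pow_succ, pow_add]
  simp only [hsplit, mul_zero, mul_one, h₀, h₁]
  rcases partialWalsh_eq_or_eq_neg φ hφ u μ α 0 with ha | ha <;>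
  rcases partialWalsh_eq_or_eq_neg φ hφ u μ α 1 with hb | hb <;>
  rcases partialWalsh_eq_or_eq_neg ψ hψ v ρ β 0 with hc | hc <;>
  rcases partialWalsh_eq_or_eq_neg ψ hψ v ρ β 1 with hd | hd <;>
  rw [ha, hb, hc, hd] <;>
  first
  | (left; ring1)
  | (right; ring1)
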